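/- arXiv:2102.00388 — 3 statements merged into one kernel-verified Lean document; each statement's English description precedes it below -/
import Mathlib

section
/- For every positive integer N, let μ_n = ∫_ℝ x^n e^{-x²} dx for n ≥ 0, and let A be the 2N×2N skew-symmetric matrix with entries a_{i,j} = (j - i) μ_{i+j-1} for 0 ≤ i, j ≤ 2N-1 (the diagonal entries are 0 and i+j-1 ≥ 0 whenever i ≠ j). Then Pf(A) = 2^{-N(N-1)} π^{N/2} ∏_{i=0}^{N-1} (2i+1)!. -/
open scoped BigOperators

/-- The Pfaffian of a `2N × 2N` real matrix, defined by
`Pf(A) = (1/(2^N N!)) ∑_{σ ∈ S_{2N}} sgn(σ) ∏_{k=1}^{N} a_{σ(2k-1),σ(2k)}`. -/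
noncomputable def pfaffian {N : ℕ} (A : Matrix (Fin (2 * N)) (Fin (2 * N)) ℝ) : ℝ :=
  (1 / (2 ^ N * (Nat.factorial N : ℝ))) *
    ∑ σ : Equiv.Perm (Fin (2 * N)),
      ((Equiv.Perm.sign σ : ℤ) : ℝ) *
        ∏ k : Fin N,
          A (σ ⟨2 * (k : ℕ), by have := k.isLt; omega⟩)
            (σ ⟨2 * (k : ℕ) + 1, by have := k.isLt; omega⟩)

/-- The `n`-th moment of the Gaussian weight `e^{-x²}` on `ℝ`. -/
noncomputable def gaussMoment (n : ℕ) : ℝ := ∫ x : ℝ, x ^ n * Real.exp (-x ^ 2)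

section

open Equiv Finset Polynomial

/-- The equivalence sending `(k, false)` to `2 * k` and `(k, true)` to `2 * k + 1`. -/
def prodBoolEquiv (N : ℕ) : Fin N × Bool ≃ Fin (2 * N) where
  toFun x := ⟨2 * x.1 + x.2.toNat, by have := x.1.isLt; cases x.2 <;> grind⟩
  invFun i := (⟨i / 2, by omega⟩, decide ((i : ℕ) % 2 = 1))
  left_inv := by
    rintro ⟨k, _ | _⟩ <;> ext <;> simp
    omega
  right_inv i := by
    ext
    rcases Nat.mod_two_eq_zero_or_one i with h | h <;> simp [h] <;> omega

theorem sum_perm_sign_mul_prod_skew {n R : Type*} [Fintype n] [DecidableEq n] [CommRing R]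
    (m : n × Bool → n × Bool → R) :
    ∑ σ : Perm (n × Bool), ((Perm.sign σ : ℤ) : R) *
        ∏ k, (m (σ (k, false)) (σ (k, true)) - m (σ (k, true)) (σ (k, false))) =
      2 ^ Fintype.card n * ∑ σ : Perm (n × Bool), ((Perm.sign σ : ℤ) : R) *
        ∏ k, m (σ (k, false)) (σ (k, true)) := by
  have expand (σ : Perm (n × Bool)) :
      ∏ k, (m (σ (k, false)) (σ (k, true)) - m (σ (k, true)) (σ (k, false))) =
        ∑ φ : n → Perm Bool, ∏ k, ((Perm.sign (φ k) : ℤ) : R) *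
          m (σ (k, φ k false)) (σ (k, φ k true)) := by
    rw [← Fintype.piFinset_univ, ← Finset.prod_univ_sum (fun _ => univ)
      (fun k (τ : Perm Bool) => ((Perm.sign τ : ℤ) : R) * m (σ (k, τ false)) (σ (k, τ true)))]
    refine prod_congr rfl fun k _ => ?_
    have : (univ : Finset (Perm Bool)) = {1, swap false true} := by decide
    rw [this, sum_pair (by decide)]
    simp [sub_eq_add_neg]
  have reindex (φ : n → Perm Bool) :
      ∑ σ : Perm (n × Bool), ((Perm.sign σ : ℤ) : R) *
          ∏ k, ((Perm.sign (φ k) : ℤ) : R) * m (σ (k, φ k false)) (σ (k, φ k true)) =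
        ∑ σ : Perm (n × Bool), ((Perm.sign σ : ℤ) : R) *
          ∏ k, m (σ (k, false)) (σ (k, true)) := by
    refine Fintype.sum_equiv (Equiv.mulRight (prodCongrRight φ : Perm (n × Bool))) _ _ fun σ => ?_
    simp only [coe_mulRight, Perm.sign_mul, Perm.sign_prodCongrRight, Perm.mul_apply,
      prodCongrRight_apply, prod_mul_distrib, Units.val_mul, Units.coe_prod, Int.cast_mul,
      Int.cast_prod, mul_assoc]
  simp_rw [expand, mul_sum]
  rw [sum_comm]
  simp_rw [reindex]
  simp [Fintype.card_perm, mul_sum]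

theorem sum_perm_sign_mul_prod_bipartite {n R : Type*} [Fintype n] [DecidableEq n] [CommRing R]
    (B : Matrix n n R) :
    ∑ σ : Perm (n × Bool), ((Perm.sign σ : ℤ) : R) *
        ∏ k, (if (σ (k, false)).2 = false ∧ (σ (k, true)).2 = true then
          B (σ (k, false)).1 (σ (k, true)).1 else 0) =
      (Fintype.card n).factorial * B.det := by
  have key : ∑ f : Bool → Perm n, ((∏ b, Perm.sign (f b) : ℤˣ) : ℤ) *
      ∏ k, B (f false k) (f true k) = (Fintype.card n).factorial * B.det := by
    rw [Fintype.sum_equiv (boolArrowEquivProd (Perm n)) _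
      (fun π => ((Perm.sign π.1 * Perm.sign π.2 : ℤˣ) : ℤ) * ∏ k, B (π.1 k) (π.2 k))
      (fun f => by simp [boolArrowEquivProd, mul_comm]), Fintype.sum_prod_type]
    have row (π : Perm n) : ∑ ρ : Perm n, (((Perm.sign π * Perm.sign ρ : ℤˣ) : ℤ) : R) *
        ∏ k, B (π k) (ρ k) = B.det := by
      have h := Matrix.det_permute π B
      rw [← Matrix.det_transpose, Matrix.det_apply'] at h
      simp only [Matrix.transpose_apply, Matrix.submatrix_apply, id] at h
      simp only [Units.val_mul, Int.cast_mul, mul_assoc, ← mul_sum, h]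
      rw [← mul_assoc, ← Int.cast_mul, ← Units.val_mul, Int.units_mul_self]
      simp
    simp_rw [row]
    simp [Fintype.card_perm]
  rw [← key]
  symm
  refine sum_of_injOn (fun f => (prodCongrLeft f : Perm (n × Bool))) ?_ (by simp) ?_ ?_
  · intro f _ g _ h
    ext b k
    have := congrArg (fun σ : Perm (n × Bool) => (σ (k, b)).1) h
    simpa using this
  · intro σ _ hσ
    by_contra hne
    have hk : ∀ k, (σ (k, false)).2 = false ∧ (σ (k, true)).2 = true := by
      intro k
      by_contra h
      exact hne (by rw [prod_eq_zero (mem_univ k) (if_neg h), mul_zero])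
    have hb : ∀ k b, (σ (k, b)).2 = b := by
      rintro k (_ | _)
      exacts [(hk k).1, (hk k).2]
    have inj (b : Bool) : Function.Injective fun k => (σ (k, b)).1 := fun k l h => by
      have := σ.injective (Prod.ext h ((hb k b).trans (hb l b).symm))
      exact congrArg Prod.fst this
    refine hσ ⟨fun b => Equiv.ofBijective _ (Finite.injective_iff_bijective.1 (inj b)),
      by simp, ?_⟩
    ext x : 1
    exact Prod.ext rfl (hb x.1 x.2).symm
  · intro f _
    simp [Perm.sign_prodCongrLeft]

/-- The Pfaffian of a skew-symmetric matrix whose entries at indices of equal parity vanish. -/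
theorem pfaffian_eq_det {N : ℕ} (a : ℕ → ℕ → ℝ) (hskew : ∀ i j, a i j = -a j i)
    (heven : ∀ p q, a (2 * p) (2 * q) = 0) (hodd : ∀ p q, a (2 * p + 1) (2 * q + 1) = 0) :
    pfaffian (fun i j : Fin (2 * N) => a i j) =
      (Matrix.of fun p q : Fin N => a (2 * p) (2 * q + 1)).det := by
  set B : Matrix (Fin N) (Fin N) ℝ := Matrix.of fun p q => a (2 * p) (2 * q + 1) with hB
  let m : Fin N × Bool → Fin N × Bool → ℝ := fun x y =>
    if x.2 = false ∧ y.2 = true then B x.1 y.1 else 0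
  have hm (x y) : a (prodBoolEquiv N x) (prodBoolEquiv N y) = m x y - m y x := by
    obtain ⟨p, _ | _⟩ := x <;> obtain ⟨q, _ | _⟩ := y <;>
      simp [m, prodBoolEquiv, hB, heven, hodd, ← hskew]
  have hsum : ∑ σ : Perm (Fin (2 * N)), ((Perm.sign σ : ℤ) : ℝ) *
      ∏ k : Fin N, a (σ ⟨2 * (k : ℕ), by have := k.isLt; omega⟩)
        (σ ⟨2 * (k : ℕ) + 1, by have := k.isLt; omega⟩) = 2 ^ N * (N.factorial * B.det) := by
    have h := sum_perm_sign_mul_prod_skew m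
    rw [sum_perm_sign_mul_prod_bipartite B, Fintype.card_fin] at h
    rw [← h]
    symm
    refine Fintype.sum_equiv (prodBoolEquiv N).permCongr _ _ fun σ => ?_
    rw [Perm.sign_permCongr]
    congr 1
    refine prod_congr rfl fun k _ => ?_
    rw [← hm]
    have h0 : (⟨2 * (k : ℕ), by have := k.isLt; omega⟩ : Fin (2 * N)) =
      prodBoolEquiv N (k, false) := by ext; simp [prodBoolEquiv]
    have h1 : (⟨2 * (k : ℕ) + 1, by have := k.isLt; omega⟩ : Fin (2 * N)) =
      prodBoolEquiv N (k, true) := by ext; simp [prodBoolEquiv]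
    rw [h0, h1, permCongr_apply, permCongr_apply, symm_apply_apply, symm_apply_apply]
  unfold pfaffian
  rw [hsum]
  field_simp

theorem integrable_pow_mul_exp_neg_sq (n : ℕ) :
    MeasureTheory.Integrable fun x : ℝ => x ^ n * Real.exp (-x ^ 2) := by
  have h := integrable_rpow_mul_exp_neg_mul_sq one_pos
    (s := n) (by have : (0 : ℝ) ≤ n := n.cast_nonneg
                 linarith)
  simpa using h

theorem gaussMoment_zero : gaussMoment 0 = √Real.pi := by
  simpa [gaussMoment] using integral_gaussian 1

theorem gaussMoment_succ (n : ℕ) : 2 * gaussMoment (n + 1) = n * gaussMoment (n - 1) := by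
  have hd (x : ℝ) : HasDerivAt (fun x : ℝ => x ^ n * Real.exp (-x ^ 2))
      (n * (x ^ (n - 1) * Real.exp (-x ^ 2)) - 2 * (x ^ (n + 1) * Real.exp (-x ^ 2))) x := by
    refine ((hasDerivAt_pow n x).mul (hasDerivAt_pow 2 x).fun_neg.exp).congr_deriv ?_
    push_cast
    ring
  have h1 := (integrable_pow_mul_exp_neg_sq (n - 1)).const_mul (n : ℝ)
  have h2 := (integrable_pow_mul_exp_neg_sq (n + 1)).const_mul 2
  have h := MeasureTheory.integral_eq_zero_of_hasDerivAt_of_integrable hd (h1.sub h2)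
    (integrable_pow_mul_exp_neg_sq n)
  rw [MeasureTheory.integral_sub h1 h2, MeasureTheory.integral_const_mul,
    MeasureTheory.integral_const_mul] at h
  simp only [gaussMoment]
  linarith

theorem gaussMoment_odd (k : ℕ) : gaussMoment (2 * k + 1) = 0 := by
  induction k with
  | zero => simpa using gaussMoment_succ 0
  | succ k ih =>
    have h := gaussMoment_succ (2 * k + 2)
    rw [show 2 * k + 2 - 1 = 2 * k + 1 by omega, ih] at h
    rw [show 2 * (k + 1) + 1 = 2 * k + 2 + 1 by omega]
    linarith

/-- The linear functional `P ↦ ∫ P(x) e^{-x²} dx` on polynomials. -/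
noncomputable def gaussFunctional : ℝ[X] →ₗ[ℝ] ℝ :=
  Polynomial.lsum fun n => gaussMoment n • LinearMap.id

theorem gaussFunctional_X_pow (n : ℕ) : gaussFunctional (X ^ n) = gaussMoment n := by
  simp [gaussFunctional, ← monomial_one_right_eq_X_pow, Polynomial.lsum, sum_monomial_index]

theorem two_mul_gaussFunctional_X_mul (P : ℝ[X]) :
    2 * gaussFunctional (X * P) = gaussFunctional (derivative P) := by
  induction P using Polynomial.induction_on' with
  | add p q hp hq => simp only [mul_add, map_add, hp, hq]
  | monomial n c =>
    rw [← C_mul_X_pow_eq_monomial, derivative_C_mul_X_pow, ← mul_assoc, X_mul_C, mul_assoc,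
      ← pow_succ', ← smul_eq_C_mul, ← smul_eq_C_mul, map_smul, map_smul, gaussFunctional_X_pow,
      gaussFunctional_X_pow, smul_eq_mul, smul_eq_mul, mul_left_comm, gaussMoment_succ, mul_assoc]

/-- The monic orthogonal polynomials of the weight `e^{-x²}`. -/
noncomputable def monicHermite : ℕ → ℝ[X]
  | 0 => 1
  | n + 1 => X * monicHermite n - C (1 / 2) * derivative (monicHermite n)

theorem monic_monicHermite_and_natDegree (n : ℕ) :
    (monicHermite n).Monic ∧ (monicHermite n).natDegree = n := by
  induction n with
  | zero => simp [monicHermite]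
  | succ n ih =>
    have hX : (X * monicHermite n).Monic := monic_X.mul ih.1
    have hdeg : (X * monicHermite n).natDegree = n + 1 := by
      rw [monic_X.natDegree_mul ih.1, ih.2, natDegree_X, add_comm]
    have hlt : (C (1 / 2) * derivative (monicHermite n)).degree <
        (X * monicHermite n).degree := by
      rw [degree_eq_natDegree hX.ne_zero, hdeg]
      refine degree_le_natDegree.trans_lt ?_
      have h1 := natDegree_C_mul_le (1 / 2 : ℝ) (derivative (monicHermite n))
      have h2 := natDegree_derivative_le (monicHermite n)
      exact_mod_cast (by omega :
        (C (1 / 2) * derivative (monicHermite n)).natDegree < n + 1)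
    exact ⟨hX.sub_of_left hlt,
      (natDegree_eq_natDegree (degree_sub_eq_left_of_degree_lt hlt)).trans hdeg⟩

theorem gaussFunctional_mul_monicHermite (n : ℕ) (P : ℝ[X]) :
    2 ^ n * gaussFunctional (P * monicHermite n) = gaussFunctional (derivative^[n] P) := by
  induction n generalizing P with
  | zero => simp [monicHermite]
  | succ n ih =>
    have h := two_mul_gaussFunctional_X_mul (P * monicHermite n)
    rw [derivative_mul, map_add] at h
    have e : P * monicHermite (n + 1) =
        X * (P * monicHermite n) - (1 / 2 : ℝ) • (P * derivative (monicHermite n)) := by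
      rw [monicHermite, smul_eq_C_mul]
      ring
    rw [Function.iterate_succ_apply, ← ih, e, map_sub, map_smul, smul_eq_mul, pow_succ]
    linear_combination 2 ^ n * h

theorem gaussFunctional_mul_monicHermite_of_natDegree_lt {n : ℕ} {P : ℝ[X]}
    (h : P.natDegree < n) : gaussFunctional (P * monicHermite n) = 0 := by
  have := gaussFunctional_mul_monicHermite n P
  rw [iterate_derivative_eq_zero h, map_zero] at this
  exact (mul_eq_zero.1 this).resolve_left (by positivity)

theorem gaussFunctional_X_pow_mul_monicHermite (n : ℕ) :
    2 ^ n * gaussFunctional (X ^ n * monicHermite n) = n.factorial * √Real.pi := by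
  rw [gaussFunctional_mul_monicHermite, iterate_derivative_X_pow_eq_smul, map_smul, Nat.sub_self,
    gaussFunctional_X_pow, gaussMoment_zero, Nat.descFactorial_self, smul_eq_mul]

/-- The pairing of `P` and `Q` by the integral of their Wronskian against the weight `e^{-x²}`, as a
linear map in `Q`. -/
noncomputable def gaussSkewForm (P : ℝ[X]) : ℝ[X] →ₗ[ℝ] ℝ :=
  gaussFunctional ∘ₗ (LinearMap.mulLeft ℝ P ∘ₗ derivative - LinearMap.mulLeft ℝ (derivative P))

theorem gaussSkewForm_apply (P Q : ℝ[X]) :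
    gaussSkewForm P Q = gaussFunctional (P * derivative Q) - gaussFunctional (derivative P * Q) := by
  simp [gaussSkewForm]

theorem gaussSkewForm_X_pow (i j : ℕ) :
    gaussSkewForm (X ^ i) (X ^ j) = ((j : ℝ) - i) * gaussMoment (i + j - 1) := by
  rw [gaussSkewForm_apply, derivative_X_pow, derivative_X_pow, mul_left_comm, mul_assoc, ← pow_add,
    ← pow_add, ← smul_eq_C_mul, ← smul_eq_C_mul, map_smul, map_smul, gaussFunctional_X_pow,
    gaussFunctional_X_pow, smul_eq_mul, smul_eq_mul]
  rcases i with _ | i <;> rcases j with _ | j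
  · simp
  · simp
  · simp
    ring
  · rw [show i + 1 + (j + 1 - 1) = i + 1 + (j + 1) - 1 by omega,
      show i + 1 - 1 + (j + 1) = i + 1 + (j + 1) - 1 by omega]
    ring

theorem gaussSkewForm_X_pow_two_mul (p q : ℕ) :
    gaussSkewForm (X ^ (2 * p)) (X ^ (2 * q)) = 0 := by
  rw [gaussSkewForm_X_pow]
  rcases Nat.eq_zero_or_pos (p + q) with h | h
  · simp [show p = 0 by omega, show q = 0 by omega]
  · rw [show 2 * p + 2 * q - 1 = 2 * (p + q - 1) + 1 by omega, gaussMoment_odd, mul_zero]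

theorem gaussSkewForm_monicHermite {n : ℕ} {P : ℝ[X]} (hP : P.natDegree < n) :
    gaussSkewForm P (monicHermite n) = 2 * gaussFunctional (X * P * monicHermite n) := by
  have h1 := two_mul_gaussFunctional_X_mul (P * monicHermite n)
  rw [derivative_mul, map_add, gaussFunctional_mul_monicHermite_of_natDegree_lt
    ((natDegree_derivative_le P).trans_lt (by omega)), ← mul_assoc] at h1
  rw [gaussSkewForm_apply, gaussFunctional_mul_monicHermite_of_natDegree_lt
    ((natDegree_derivative_le P).trans_lt (by omega)), h1]
  ring

theorem gaussSkewForm_X_pow_monicHermite_of_lt {i n : ℕ} (h : i + 1 < n) :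
    gaussSkewForm (X ^ i) (monicHermite n) = 0 := by
  rw [gaussSkewForm_monicHermite (by rw [natDegree_X_pow]; omega), ← pow_succ',
    gaussFunctional_mul_monicHermite_of_natDegree_lt (by rwa [natDegree_X_pow]), mul_zero]

theorem gaussSkewForm_X_pow_monicHermite_succ (n : ℕ) :
    2 ^ n * gaussSkewForm (X ^ n) (monicHermite (n + 1)) = (n + 1).factorial * √Real.pi := by
  rw [gaussSkewForm_monicHermite (by rw [natDegree_X_pow]; omega), ← pow_succ',
    ← gaussFunctional_X_pow_mul_monicHermite]
  ring

theorem sum_range_two_mul {M : Type*} [AddCommMonoid M] (f : ℕ → M) (N : ℕ) :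
    ∑ j ∈ range (2 * N), f j = ∑ k ∈ range N, (f (2 * k) + f (2 * k + 1)) := by
  induction N with
  | zero => simp
  | succ N ih =>
    rw [sum_range_succ, ← ih, mul_add, mul_one, sum_range_succ, sum_range_succ, add_assoc]

theorem det_gaussSkewForm_X_pow (N : ℕ) :
    (Matrix.of fun p q : Fin N =>
        gaussSkewForm (X ^ (2 * (p : ℕ))) (X ^ (2 * (q : ℕ) + 1))).det =
      ∏ i ∈ range N, ((2 * i + 1).factorial * √Real.pi / 2 ^ (2 * i)) := by
  set B : Matrix (Fin N) (Fin N) ℝ := Matrix.of fun p q =>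
    gaussSkewForm (X ^ (2 * (p : ℕ))) (X ^ (2 * (q : ℕ) + 1)) with hB
  let U : Matrix (Fin N) (Fin N) ℝ := Matrix.of fun k q =>
    (monicHermite (2 * q + 1)).coeff (2 * k + 1)
  have hU : U.det = 1 := by
    rw [Matrix.det_of_isUpperTriangular]
    · refine prod_eq_one fun q _ => ?_
      obtain ⟨hm, hd⟩ := monic_monicHermite_and_natDegree (2 * q + 1)
      simpa [U, hd] using hm.coeff_natDegree
    · intro k q (hkq : q < k)
      refine coeff_eq_zero_of_natDegree_lt (p := monicHermite (2 * q + 1)) ?_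
      rw [(monic_monicHermite_and_natDegree _).2]
      omega
  have hBU (p q : Fin N) :
      (B * U) p q = gaussSkewForm (X ^ (2 * (p : ℕ))) (monicHermite (2 * q + 1)) := by
    have hq : (monicHermite (2 * (q : ℕ) + 1)).natDegree < 2 * N := by
      rw [(monic_monicHermite_and_natDegree _).2]
      omega
    conv_rhs => rw [as_sum_range' _ _ hq]
    rw [map_sum, sum_range_two_mul, Matrix.mul_apply, ← Fin.sum_univ_eq_sum_range
      (fun k => gaussSkewForm (X ^ (2 * (p : ℕ)))
          (monomial (2 * k) ((monicHermite (2 * (q : ℕ) + 1)).coeff (2 * k))) +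
        gaussSkewForm (X ^ (2 * (p : ℕ)))
          (monomial (2 * k + 1) ((monicHermite (2 * (q : ℕ) + 1)).coeff (2 * k + 1))))]
    refine sum_congr rfl fun k _ => ?_
    simp only [← C_mul_X_pow_eq_monomial, ← smul_eq_C_mul, map_smul,
      gaussSkewForm_X_pow_two_mul, smul_zero, zero_add]
    simp [hB, U, mul_comm]
  have hdet : B.det = (B * U).det := by rw [Matrix.det_mul, hU, mul_one]
  rw [hdet, Matrix.det_of_isLowerTriangular, ← Fin.prod_univ_eq_prod_range
    (fun i => ((2 * i + 1).factorial * √Real.pi / 2 ^ (2 * i) : ℝ))]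
  · refine prod_congr rfl fun i _ => ?_
    rw [hBU, eq_div_iff (by positivity), mul_comm, gaussSkewForm_X_pow_monicHermite_succ]
  · intro p q hpq
    have hpq' : p < q := hpq
    rw [hBU, gaussSkewForm_X_pow_monicHermite_of_lt (by omega)]

end

theorem pfaffian_hermite (N : ℕ) (hN : 0 < N) :
    pfaffian (fun i j : Fin (2 * N) =>
        (((j : ℕ) : ℝ) - ((i : ℕ) : ℝ)) * gaussMoment ((i : ℕ) + (j : ℕ) - 1)) =
      (2 : ℝ) ^ (-(N * (N - 1) : ℤ)) * Real.pi ^ ((N : ℝ) / 2) *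
        ∏ i ∈ Finset.range N, (Nat.factorial (2 * i + 1) : ℝ) := by
  have h := pfaffian_eq_det (N := N) (fun i j => ((j : ℝ) - i) * gaussMoment (i + j - 1))
    (fun i j => by rw [add_comm j i]; ring)
    (fun p q => by
      rw [← gaussSkewForm_X_pow, gaussSkewForm_X_pow_two_mul])
    (fun p q => by
      rw [show 2 * p + 1 + (2 * q + 1) - 1 = 2 * (p + q) + 1 by omega, gaussMoment_odd, mul_zero])
  simp only [← gaussSkewForm_X_pow] at h ⊢
  rw [h, det_gaussSkewForm_X_pow]
  have hpi : Real.pi ^ ((N : ℝ) / 2) = √Real.pi ^ N := by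
    rw [Real.sqrt_eq_rpow, ← Real.rpow_natCast, ← Real.rpow_mul Real.pi_pos.le]
    congr 1
    ring
  have hpow : ∏ i ∈ Finset.range N, (2 : ℝ) ^ (2 * i) = 2 ^ (N * (N - 1)) := by
    rw [Finset.prod_pow_eq_pow_sum, ← Finset.mul_sum, mul_comm, Finset.sum_range_id_mul_two]
  have hexp : (-(N * (N - 1) : ℤ)) = -((N * (N - 1) : ℕ) : ℤ) := by
    push_cast [Nat.cast_pred hN]
    rfl
  rw [Finset.prod_div_distrib, Finset.prod_mul_distrib, Finset.prod_const, Finset.card_range, hpow,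
    hpi, hexp, zpow_neg, zpow_natCast]
  ring
end

section
/- Let a be a real number with a > -2 and N a positive integer. Let A be the 2N×2N skew-symmetric matrix with entries a_{i,j} = (j - i) Γ(i + j + a + 1) for 0 ≤ i, j ≤ 2N-1. Then Pf(A) = ∏_{i=0}^{N-1} (2i+1)! · Γ(2i + a + 2). (Here Γ(i+j+a+1) = ∫_0^∞ x^{i+j-1} · x^{a+1} e^{-x} dx is the (i+j-1)-th moment of the Laguerre-type weight x^{a+1} e^{-x} on (0,∞).) -/
open scoped BigOperators

open Equiv Polynomial

/-- The pairing of the indices `2k` and `2k + 1`. -/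
def pairEquiv (N : ℕ) : Fin N × Fin 2 ≃ Fin (2 * N) :=
  finProdFinEquiv.trans (finCongr (mul_comm N 2))

lemma pairEquiv_val {N : ℕ} (x : Fin N × Fin 2) :
    (pairEquiv N x : ℕ) = (x.2 : ℕ) + 2 * (x.1 : ℕ) := rfl

/-- The signed sum over permutations in the Pfaffian, for matrices indexed by `Fin N × Fin 2`. -/
noncomputable def pfaffianSum {N : ℕ} (A : Matrix (Fin N × Fin 2) (Fin N × Fin 2) ℝ) : ℝ :=
  ∑ σ : Perm (Fin N × Fin 2), ((Perm.sign σ : ℤ) : ℝ) * ∏ k : Fin N, A (σ (k, 0)) (σ (k, 1))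

lemma pfaffian_eq_pfaffianSum {N : ℕ} (A : Matrix (Fin (2 * N)) (Fin (2 * N)) ℝ) :
    pfaffian A = (1 / (2 ^ N * (Nat.factorial N : ℝ))) *
      pfaffianSum (A.submatrix (pairEquiv N) (pairEquiv N)) := by
  unfold pfaffian pfaffianSum
  congr 1
  refine (Fintype.sum_equiv (pairEquiv N).permCongr _ _ fun σ => ?_).symm
  rw [Perm.sign_permCongr]
  congr 1
  refine Finset.prod_congr rfl fun k _ => ?_
  have h0 : (⟨2 * (k : ℕ), by have := k.isLt; omega⟩ : Fin (2 * N)) = pairEquiv N (k, 0) :=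
    Fin.ext (by simp [pairEquiv_val])
  have h1 : (⟨2 * (k : ℕ) + 1, by have := k.isLt; omega⟩ : Fin (2 * N)) = pairEquiv N (k, 1) :=
    Fin.ext (by simp [pairEquiv_val, add_comm])
  simp [h0, h1, Equiv.permCongr_apply]

lemma sum_sign_mul_prod_eq {n : Type*} [Fintype n] [DecidableEq n] (B : Matrix n n ℝ) (g : n → n) :
    ∑ σ : Perm n, ((Perm.sign σ : ℤ) : ℝ) * ∏ i, B (σ i) (g i) = (B.submatrix id g).det := by
  rw [Matrix.det_apply']
  rfl

lemma pfaffianSum_eq_sum_functions {N : ℕ} (A B : Matrix (Fin N × Fin 2) (Fin N × Fin 2) ℝ) :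
    pfaffianSum (B * A * B.transpose) =
      ∑ g : Fin N × Fin 2 → Fin N × Fin 2,
        (B.submatrix id g).det * ∏ k : Fin N, A (g (k, 0)) (g (k, 1)) := by
  have key (p q : Fin N × Fin 2) : (B * A * B.transpose) p q =
      ∑ u : Fin 2 → Fin N × Fin 2, B p (u 0) * B q (u 1) * A (u 0) (u 1) := by
    rw [← (finTwoArrowEquiv (Fin N × Fin 2)).symm.sum_comp, Fintype.sum_prod_type_right]
    simp only [Matrix.mul_apply, Matrix.transpose_apply, Finset.sum_mul]
    refine Finset.sum_congr rfl fun x _ => Finset.sum_congr rfl fun y _ => ?_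
    simp [finTwoArrowEquiv]
    ring
  unfold pfaffianSum
  simp only [key, Fintype.prod_sum, Finset.mul_sum]
  rw [Finset.sum_comm, ← (Equiv.curry (Fin N) (Fin 2) (Fin N × Fin 2)).sum_comp]
  refine Finset.sum_congr rfl fun g _ => ?_
  rw [← sum_sign_mul_prod_eq, Finset.sum_mul]
  refine Finset.sum_congr rfl fun σ _ => ?_
  simp [Fintype.prod_prod_type, Finset.prod_mul_distrib, Function.curry, mul_assoc]

lemma pfaffianSum_congruence {N : ℕ} (A B : Matrix (Fin N × Fin 2) (Fin N × Fin 2) ℝ) :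
    pfaffianSum (B * A * B.transpose) = B.det * pfaffianSum A := by
  rw [pfaffianSum_eq_sum_functions, pfaffianSum, Finset.mul_sum]
  refine (Fintype.sum_of_injective (fun σ : Perm (Fin N × Fin 2) => (σ : _ → _))
    DFunLike.coe_injective _ _ (fun g hg => ?_) fun σ => ?_).symm
  · have hinj : ¬ Function.Injective g := fun h =>
      hg ⟨Equiv.ofBijective g (Finite.injective_iff_bijective.1 h), rfl⟩
    simp only [Function.Injective, not_forall] at hinj
    obtain ⟨i, j, hij, hne⟩ := hinj
    rw [Matrix.det_zero_of_column_eq hne (fun k => by simp [hij]), zero_mul]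
  · rw [Matrix.det_permute']
    ring

lemma fst_involution_eq {N : ℕ} (f : Fin N × Fin 2 → Fin N × Fin 2) (hf : ∀ x, f (f x) = x)
    (hadj : ∀ x, (pairEquiv N x : ℕ) + 1 = pairEquiv N (f x) ∨
      (pairEquiv N (f x) : ℕ) + 1 = pairEquiv N x) (x : Fin N × Fin 2) : (f x).1 = x.1 := by
  induction h : (pairEquiv N x : ℕ) using Nat.strong_induction_on generalizing x with
  | _ m ih =>
    subst h
    by_contra hne
    have hne' : ((f x).1 : ℕ) ≠ x.1 := fun h => hne (Fin.ext h)
    have hx := hadj x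
    have h1 := (f x).2.isLt
    have h2 := x.2.isLt
    rw [pairEquiv_val, pairEquiv_val] at hx
    rcases hx with hx | hx
    · have hy := hadj (x.1, 0)
      have hlt : (pairEquiv N (x.1, 0) : ℕ) < pairEquiv N x := by
        simp only [pairEquiv_val, Fin.val_zero]; omega
      have hfst := congrArg Fin.val (ih _ hlt (x.1, 0) rfl)
      have h3 := (f (x.1, 0)).2.isLt
      simp only [pairEquiv_val, Fin.val_zero] at hy hfst
      have hfx : f (x.1, 0) = x := (pairEquiv N).injective
        (Fin.ext (by simp only [pairEquiv_val]; omega))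
      have hxf : f x = (x.1, 0) := by rw [← hf (x.1, 0), hfx]
      exact hne (by rw [hxf])
    · have hlt : (pairEquiv N (f x) : ℕ) < pairEquiv N x := by
        simp only [pairEquiv_val]; omega
      have hfst := ih _ hlt (f x) rfl
      rw [hf] at hfst
      exact hne hfst.symm

/-- The permutation that permutes the pairs by `p.1` and permutes within pairs by `p.2`. -/
def pairPerm {N : ℕ} (p : Perm (Fin N) × (Fin N → Perm (Fin 2))) : Perm (Fin N × Fin 2) :=
  (prodCongrRight p.2).trans (prodCongrLeft fun _ => p.1)

lemma pairPerm_apply {N : ℕ} (p : Perm (Fin N) × (Fin N → Perm (Fin 2))) (k : Fin N) (b : Fin 2) :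
    pairPerm p (k, b) = (p.1 k, p.2 k b) := rfl

lemma pairPerm_injective {N : ℕ} : Function.Injective (pairPerm (N := N)) := by
  intro p q h
  have h' (k : Fin N) (b : Fin 2) : (p.1 k, p.2 k b) = (q.1 k, q.2 k b) := by
    rw [← pairPerm_apply, ← pairPerm_apply, h]
  refine Prod.ext (Equiv.ext fun k => ?_) (funext fun k => Equiv.ext fun b => ?_)
  · exact congrArg Prod.fst (h' k 0)
  · exact congrArg Prod.snd (h' k b)

lemma sign_pairPerm {N : ℕ} (p : Perm (Fin N) × (Fin N → Perm (Fin 2))) :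
    Perm.sign (pairPerm p) = ∏ k, Perm.sign (p.2 k) := by
  rw [pairPerm, Perm.sign_trans, Perm.sign_prodCongrLeft, Perm.sign_prodCongrRight]
  simp

lemma mem_range_pairPerm {N : ℕ} (σ : Perm (Fin N × Fin 2))
    (h : ∀ k, (σ (k, 0)).1 = (σ (k, 1)).1) : σ ∈ Set.range pairPerm := by
  have hne (k : Fin N) : (σ (k, 0)).2 ≠ (σ (k, 1)).2 := fun h' => by
    have := σ.injective (Prod.ext (h k) h')
    simp at this
  have hinj : Function.Injective fun k => (σ (k, 0)).1 := by
    intro k l hkl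
    have hcases : (σ (k, 0)).2 = (σ (l, 0)).2 ∨ (σ (k, 0)).2 = (σ (l, 1)).2 := by
      have := hne l
      omega
    rcases hcases with hc | hc
    · exact congrArg Prod.fst (σ.injective (Prod.ext hkl hc))
    · exact congrArg Prod.fst (σ.injective (Prod.ext (hkl.trans (h l)) hc))
  refine ⟨(Equiv.ofBijective _ (Finite.injective_iff_bijective.1 hinj),
    fun k => swap 0 (σ (k, 0)).2), Equiv.ext fun ⟨k, b⟩ => ?_⟩
  rw [pairPerm_apply]
  have hk := hne k
  match b with
  | 0 => exact Prod.ext rfl (swap_apply_left _ _)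
  | 1 =>
    refine Prod.ext (h k) ?_
    have (u v : Fin 2) (huv : u ≠ v) : swap 0 u 1 = v := by revert u v; decide
    exact this _ _ hk

lemma pfaffianSum_tridiagonal {N : ℕ} (M : Matrix (Fin N × Fin 2) (Fin N × Fin 2) ℝ)
    (hskew : ∀ x y, M x y = -M y x)
    (hzero : ∀ x y, (pairEquiv N x : ℕ) + 1 < pairEquiv N y → M x y = 0) :
    pfaffianSum M = 2 ^ N * (Nat.factorial N : ℝ) * ∏ k : Fin N, M (k, 0) (k, 1) := by
  have hdiag (x) : M x x = 0 := by linarith [hskew x x]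
  have hadj (x y) (hxy : M x y ≠ 0) : (pairEquiv N x : ℕ) + 1 = pairEquiv N y ∨
      (pairEquiv N y : ℕ) + 1 = pairEquiv N x := by
    by_contra! hcon
    rcases lt_trichotomy (pairEquiv N x : ℕ) (pairEquiv N y) with hlt | heq | hlt
    · exact hxy (hzero x y (by omega))
    · exact hxy ((pairEquiv N).injective (Fin.ext heq) ▸ hdiag x)
    · exact hxy (by rw [hskew, hzero y x (by omega), neg_zero])
  have hsum : ∑ _p : Perm (Fin N) × (Fin N → Perm (Fin 2)), ∏ k : Fin N, M (k, 0) (k, 1) =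
      pfaffianSum M := by
    refine Fintype.sum_of_injective pairPerm pairPerm_injective _ _ (fun σ hσ => ?_) fun p => ?_
    · by_contra hne
      have hprod := right_ne_zero_of_mul hne
      rw [Finset.prod_ne_zero_iff] at hprod
      refine hσ (mem_range_pairPerm σ fun k => ?_)
      have := fst_involution_eq
        (fun x => σ ((σ.symm x).1, Equiv.swap 0 1 (σ.symm x).2)) (fun x => by simp)
        (fun x => by
          obtain ⟨⟨l, b⟩, rfl⟩ := σ.surjective x
          have := hadj _ _ (hprod l (Finset.mem_univ l))
          match b with
          | 0 => simpa using this
          | 1 => simpa using this.symm) (σ (k, 1))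
      simpa using this
    · rw [sign_pairPerm]
      push_cast
      rw [← Finset.prod_mul_distrib, ← Equiv.prod_comp p.1]
      refine Finset.prod_congr rfl fun k _ => ?_
      rw [pairPerm_apply, pairPerm_apply]
      have (e : Perm (Fin 2)) : e = 1 ∨ e = swap 0 1 := by revert e; decide
      rcases this (p.2 k) with he | he
      · simp [he]
      · rw [he, hskew]
        simp
  rw [← hsum]
  rw [Finset.sum_const, Finset.card_univ, Fintype.card_prod, Fintype.card_fun]
  simp only [Fintype.card_perm, Fintype.card_fin, Nat.factorial_two, nsmul_eq_mul]
  push_cast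
  ring

/-- The coefficient of `x ^ k` in the monic Laguerre polynomial of degree `n` with parameter `a`. -/
noncomputable def laguerreCoeff (a : ℝ) (n k : ℕ) : ℝ :=
  (-1) ^ (n - k) * (n.choose k : ℝ) * (ascPochhammer ℝ (n - k)).eval (a + k + 1)

lemma laguerreCoeff_self (a : ℝ) (n : ℕ) : laguerreCoeff a n n = 1 := by simp [laguerreCoeff]

lemma laguerreCoeff_of_lt (a : ℝ) {n k : ℕ} (h : n < k) : laguerreCoeff a n k = 0 := by
  simp [laguerreCoeff, Nat.choose_eq_zero_of_lt h]

lemma Gamma_add_nat_eq (s : ℝ) (hs : 0 < s) (m : ℕ) :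
    Real.Gamma (s + m) = (ascPochhammer ℝ m).eval s * Real.Gamma s := by
  induction m with
  | zero => simp
  | succ m ih =>
    have : s + m ≠ 0 := by positivity
    rw [Nat.cast_succ, ← add_assoc, Real.Gamma_add_one this, ih, ascPochhammer_succ_eval]
    ring

lemma ascPochhammer_eval_add (s : ℝ) (m n : ℕ) :
    (ascPochhammer ℝ (m + n)).eval s =
      (ascPochhammer ℝ m).eval s * (ascPochhammer ℝ n).eval (s + m) := by
  rw [← ascPochhammer_mul]
  simp

lemma ascPochhammer_mul_Gamma_comm (s : ℝ) (m i : ℕ) (hm : 0 < s + m) (hi : 0 < s + i) :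
    (ascPochhammer ℝ m).eval s * Real.Gamma (s + i) =
      (ascPochhammer ℝ i).eval s * Real.Gamma (s + m) := by
  wlog h : i ≤ m generalizing m i
  · exact (this i m hi hm (by omega)).symm
  obtain ⟨d, rfl⟩ := Nat.exists_eq_add_of_le h
  rw [ascPochhammer_eval_add, Nat.cast_add, ← add_assoc, Gamma_add_nat_eq _ hi]
  ring

lemma sum_choose_mul_ascPochhammer (a : ℝ) (i n : ℕ) (h : i + 1 ≤ n) :
    ∑ k ∈ Finset.range (n + 1), (-1 : ℝ) ^ (n - k) * (n.choose k : ℝ) *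
      (((k : ℝ) - i) * (ascPochhammer ℝ i).eval (a + k + 1)) =
        if i + 1 = n then (n.factorial : ℝ) else 0 := by
  set P : ℝ[X] := (X - C (i : ℝ)) * (ascPochhammer ℝ i).comp (X + C (a + 1)) with hP
  have hm : ((ascPochhammer ℝ i).comp (X + C (a + 1))).Monic :=
    (monic_ascPochhammer ℝ i).comp_X_add_C _
  have hmonic : P.Monic := (monic_X_sub_C _).mul hm
  have hdeg : P.natDegree = i + 1 := by
    rw [hP, (monic_X_sub_C _).natDegree_mul hm, natDegree_X_sub_C, natDegree_comp,
      ascPochhammer_natDegree, natDegree_X_add_C]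
    ring
  have hsum := fwdDiff_iter_eq_sum_shift (1 : ℝ) P.eval n 0
  have heval (k : ℕ) : P.eval ((0 : ℝ) + k • (1 : ℝ)) =
      ((k : ℝ) - i) * (ascPochhammer ℝ i).eval (a + k + 1) := by
    simp only [hP, eval_mul, eval_comp, eval_sub, eval_add, eval_X, eval_C, nsmul_eq_mul, mul_one,
      zero_add]
    ring_nf
  simp only [heval, zsmul_eq_mul] at hsum
  push_cast at hsum
  rw [← hsum]
  split_ifs with hn
  · have := P.fwdDiff_iter_degree_eq_factorial
    rw [hdeg, hn, hmonic.leadingCoeff] at this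
    rw [this]
    simp
  · rw [Polynomial.fwdDiff_iter_eq_zero_of_degree_lt (by omega)]
    rfl

lemma sum_laguerreCoeff_mul_moment (a : ℝ) (ha : -2 < a) (i n : ℕ) (h : i + 1 ≤ n) :
    ∑ k ∈ Finset.range (n + 1), laguerreCoeff a n k *
      (((k : ℝ) - i) * Real.Gamma ((i : ℝ) + k + a + 1)) =
        if i + 1 = n then (n.factorial : ℝ) * Real.Gamma (n + a + 1) else 0 := by
  have hn : (1 : ℝ) ≤ n := by exact_mod_cast (by omega : 1 ≤ n)
  rw [← zero_mul (Real.Gamma (n + a + 1)), ← ite_mul, ← sum_choose_mul_ascPochhammer a i n h,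
    Finset.sum_mul]
  refine Finset.sum_congr rfl fun k hk => ?_
  by_cases hki : k = i
  · simp [hki]
  have hkn : k ≤ n := by simpa [Nat.lt_succ_iff] using hk
  have hik : (1 : ℝ) ≤ i + k := by exact_mod_cast (by omega : 1 ≤ i + k)
  have hs : (a + k + 1) + ((n - k : ℕ) : ℝ) = n + a + 1 := by
    rw [Nat.cast_sub hkn]; ring
  have hcomm := ascPochhammer_mul_Gamma_comm (a + k + 1) (n - k) i
    (by rw [hs]; linarith) (by linarith)
  rw [hs, show a + k + 1 + (i : ℝ) = i + k + a + 1 by ring] at hcomm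
  rw [laguerreCoeff]
  linear_combination (-1) ^ (n - k) * (n.choose k : ℝ) * ((k : ℝ) - i) * hcomm

/-- The moment matrix of the skew-symmetric Laguerre inner product. -/
noncomputable def laguerreMoment (a : ℝ) (n : ℕ) : Matrix (Fin n) (Fin n) ℝ := fun i j =>
  (((j : ℕ) : ℝ) - ((i : ℕ) : ℝ)) * Real.Gamma (((i : ℕ) : ℝ) + ((j : ℕ) : ℝ) + a + 1)

/-- The matrix of coefficients of the monic Laguerre polynomials. -/
noncomputable def laguerreCoeffMatrix (a : ℝ) (n : ℕ) : Matrix (Fin n) (Fin n) ℝ := fun i j =>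
  laguerreCoeff a i j

lemma det_laguerreCoeffMatrix (a : ℝ) (n : ℕ) : (laguerreCoeffMatrix a n).det = 1 := by
  rw [Matrix.det_of_isLowerTriangular]
  · simp [laguerreCoeffMatrix, laguerreCoeff_self]
  · intro i j hij
    exact laguerreCoeff_of_lt a (by simpa using hij)

lemma laguerreMoment_transpose (a : ℝ) (n : ℕ) :
    (laguerreMoment a n).transpose = -laguerreMoment a n := by
  ext i j
  simp only [laguerreMoment, Matrix.transpose_apply, Matrix.neg_apply]
  rw [add_comm ((j : ℕ) : ℝ)]
  ring

lemma laguerreMoment_mul_transpose_apply (a : ℝ) (ha : -2 < a) (n : ℕ) (i j : Fin n)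
    (h : (i : ℕ) + 1 ≤ j) :
    (laguerreMoment a n * (laguerreCoeffMatrix a n).transpose) i j =
      if (i : ℕ) + 1 = j then ((j : ℕ).factorial : ℝ) * Real.Gamma ((j : ℕ) + a + 1) else 0 := by
  rw [← sum_laguerreCoeff_mul_moment a ha i j h, Matrix.mul_apply]
  simp only [laguerreMoment, laguerreCoeffMatrix, Matrix.transpose_apply]
  rw [Fin.sum_univ_eq_sum_range (fun k : ℕ => ((k : ℝ) - ((i : ℕ) : ℝ)) *
    Real.Gamma (((i : ℕ) : ℝ) + k + a + 1) * laguerreCoeff a j k) n]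
  rw [← Finset.sum_subset (Finset.range_mono (show (j : ℕ) + 1 ≤ n from j.isLt))]
  · exact Finset.sum_congr rfl fun k _ => mul_comm _ _
  · intro k _ hk
    rw [laguerreCoeff_of_lt a (by simpa using hk), mul_zero]

/-- The skew-symmetric Laguerre moment matrix in the basis of monic Laguerre polynomials. -/
noncomputable def laguerreSkew (a : ℝ) (n : ℕ) : Matrix (Fin n) (Fin n) ℝ :=
  laguerreCoeffMatrix a n * laguerreMoment a n * (laguerreCoeffMatrix a n).transpose

lemma laguerreSkew_swap (a : ℝ) (n : ℕ) (i j : Fin n) :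
    laguerreSkew a n i j = -laguerreSkew a n j i := by
  have h : (laguerreSkew a n).transpose = -laguerreSkew a n := by
    simp [laguerreSkew, Matrix.transpose_mul, laguerreMoment_transpose, Matrix.mul_assoc]
  rw [← Matrix.neg_apply, ← h, Matrix.transpose_apply]

lemma laguerreSkew_apply (a : ℝ) (ha : -2 < a) (n : ℕ) (i j : Fin n) (h : (i : ℕ) + 1 ≤ j) :
    laguerreSkew a n i j =
      if (i : ℕ) + 1 = j then ((j : ℕ).factorial : ℝ) * Real.Gamma ((j : ℕ) + a + 1) else 0 := by
  rw [laguerreSkew, Matrix.mul_assoc, Matrix.mul_apply, Finset.sum_eq_single i]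
  · rw [laguerreMoment_mul_transpose_apply a ha n i j h, laguerreCoeffMatrix, laguerreCoeff_self,
      one_mul]
  · intro k _ hk
    have hk' : (k : ℕ) ≠ i := fun h' => hk (Fin.ext h')
    rcases lt_or_gt_of_ne hk' with hlt | hgt
    · rw [laguerreMoment_mul_transpose_apply a ha n k j (by omega), if_neg (by omega), mul_zero]
    · rw [laguerreCoeffMatrix, laguerreCoeff_of_lt a hgt, zero_mul]
  · simp

theorem pfaffian_laguerre (a : ℝ) (ha : -2 < a) (N : ℕ) (hN : 0 < N) :
    pfaffian (fun i j : Fin (2 * N) =>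
        (((j : ℕ) : ℝ) - ((i : ℕ) : ℝ)) * Real.Gamma (((i : ℕ) : ℝ) + ((j : ℕ) : ℝ) + a + 1)) =
      ∏ i ∈ Finset.range N, (Nat.factorial (2 * i + 1) : ℝ) * Real.Gamma (2 * (i : ℝ) + a + 2) := by
  change pfaffian (laguerreMoment a (2 * N)) = _
  set e := pairEquiv N with he
  have hcong : pfaffianSum ((laguerreMoment a (2 * N)).submatrix e e) =
      pfaffianSum ((laguerreSkew a (2 * N)).submatrix e e) := by
    have := pfaffianSum_congruence ((laguerreMoment a (2 * N)).submatrix e e)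
      ((laguerreCoeffMatrix a (2 * N)).submatrix e e)
    rw [Matrix.det_submatrix_equiv_self, det_laguerreCoeffMatrix, one_mul,
      Matrix.transpose_submatrix, Matrix.submatrix_mul_equiv, Matrix.submatrix_mul_equiv] at this
    exact this.symm
  rw [pfaffian_eq_pfaffianSum, ← he, hcong, pfaffianSum_tridiagonal, ← mul_assoc,
    one_div_mul_cancel (by positivity), one_mul, ← Fin.prod_univ_eq_prod_range (fun i : ℕ =>
      (Nat.factorial (2 * i + 1) : ℝ) * Real.Gamma (2 * (i : ℝ) + a + 2)) N]
  · refine Finset.prod_congr rfl fun k _ => ?_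
    have h0 : (e (k, 0) : ℕ) = 2 * k := by simp [he, pairEquiv_val]
    have h1 : (e (k, 1) : ℕ) = 2 * k + 1 := by simp [he, pairEquiv_val, add_comm]
    rw [Matrix.submatrix_apply, laguerreSkew_apply a ha _ _ _ (by omega), if_pos (by omega), h1]
    push_cast
    ring_nf
  · exact fun x y => laguerreSkew_swap a _ _ _
  · intro x y hxy
    rw [← he] at hxy
    rw [Matrix.submatrix_apply, laguerreSkew_apply a ha _ _ _ (by omega), if_neg (by omega)]
end

section
/- Let q be a real number with 0 < q < 1, a an arbitrary real number, and N a positive integer. Let A be the 2N×2N skew-symmetric matrix with entries a_{i,j} = (q^i - q^j) ∑_{k=0}^{i+j-1} C_q(i+j-1, k) a^k for 0 ≤ i, j ≤ 2N-1 (the sum is empty and the entry is 0 when i = j = 0; diagonal entries are 0). Then Pf(A) = a^{N(N-1)} q^{N(N-1)(4N-5)/6} ∏_{k=0}^{N-1} (q;q)_{2k+1}. (This is the Catalan–Hankel Pfaffian evaluation attached to the Al-Salam–Carlitz I weight.) -/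
open scoped BigOperators

/-- The finite q-Pochhammer symbol `(a;q)_n = ∏_{k=0}^{n-1} (1 - a q^k)`. -/
noncomputable def qPoch (a q : ℝ) (n : ℕ) : ℝ := ∏ k ∈ Finset.range n, (1 - a * q ^ k)

/-- The q-binomial coefficient `C_q(n,k) = (q;q)_n / ((q;q)_k (q;q)_{n-k})`. -/
noncomputable def qBinom (q : ℝ) (n k : ℕ) : ℝ :=
  qPoch q q n / (qPoch q q k * qPoch q q (n - k))

open Finset Polynomial

section PairedSum

variable {R ι : Type*} [CommRing R] [Fintype ι] [DecidableEq ι]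

/-- The unnormalised Pfaffian of a matrix whose rows and columns are indexed by `ι × Fin 2`. -/
def pairedSum (A : Matrix (ι × Fin 2) (ι × Fin 2) R) : R :=
  ∑ σ : Equiv.Perm (ι × Fin 2),
    ((Equiv.Perm.sign σ : ℤ) : R) * ∏ k : ι, A (σ (k, 0)) (σ (k, 1))

lemma prod_congruence_expand (P A : Matrix (ι × Fin 2) (ι × Fin 2) R)
    (x : ι × Fin 2 → ι × Fin 2) :
    ∏ k : ι, (P * A * P.transpose) (x (k, 0)) (x (k, 1)) =
      ∑ f : ι × Fin 2 → ι × Fin 2,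
        (∏ k : ι, A (f (k, 0)) (f (k, 1))) * ∏ i : ι × Fin 2, P (x i) (f i) := by
  have key (k : ι) : (P * A * P.transpose) (x (k, 0)) (x (k, 1)) =
      ∑ h : Fin 2 → ι × Fin 2, A (h 0) (h 1) * ∏ b : Fin 2, P (x (k, b)) (h b) := by
    rw [← (finTwoArrowEquiv (ι × Fin 2)).symm.sum_comp, Fintype.sum_prod_type_right]
    simp only [Matrix.mul_apply, Matrix.transpose_apply, Finset.sum_mul]
    refine Finset.sum_congr rfl fun v _ => Finset.sum_congr rfl fun u _ => ?_
    simp [finTwoArrowEquiv, Fin.prod_univ_two]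
    ring
  simp_rw [key]
  rw [Fintype.prod_sum, ← (Equiv.curry ι (Fin 2) (ι × Fin 2)).sum_comp]
  refine Finset.sum_congr rfl fun f _ => ?_
  rw [Finset.prod_mul_distrib, Fintype.prod_prod_type]
  rfl

/-- The unnormalised Pfaffian is multiplied by the determinant under congruence. -/
theorem pairedSum_congruence (P A : Matrix (ι × Fin 2) (ι × Fin 2) R) :
    pairedSum (P * A * P.transpose) = P.det * pairedSum A := by
  have hdet : pairedSum (P * A * P.transpose) =
      ∑ f : ι × Fin 2 → ι × Fin 2,
        (∏ k : ι, A (f (k, 0)) (f (k, 1))) * (P.submatrix id f).det := by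
    simp_rw [pairedSum, prod_congruence_expand P A, Finset.mul_sum]
    rw [Finset.sum_comm]
    refine Finset.sum_congr rfl fun f _ => ?_
    rw [Matrix.det_apply', Finset.mul_sum]
    refine Finset.sum_congr rfl fun σ _ => ?_
    simp only [Matrix.submatrix_apply, id]
    ring
  rw [hdet, pairedSum, Finset.mul_sum]
  symm
  refine Finset.sum_of_injOn (fun σ : Equiv.Perm (ι × Fin 2) => (σ : ι × Fin 2 → ι × Fin 2))
    (fun σ _ τ _ h => DFunLike.coe_injective h) (by simp [Set.MapsTo]) ?_ ?_
  · intro f _ hf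
    have hinj : ¬ Function.Injective f := fun h =>
      hf ⟨Equiv.ofBijective f (Finite.injective_iff_bijective.mp h), by simp, rfl⟩
    obtain ⟨i, j, hij, hne⟩ : ∃ i j, f i = f j ∧ i ≠ j := by
      simpa only [Function.Injective, not_forall, exists_prop] using hinj
    rw [Matrix.det_zero_of_column_eq hne (by simp [hij]), mul_zero]
  · intro σ _
    rw [Matrix.det_permute']
    ring

lemma perm_fin_two_cases (ε : Equiv.Perm (Fin 2)) : ε = 1 ∨ ε = Equiv.swap 0 1 := by
  revert ε; decide

lemma sign_prodShear (π : Equiv.Perm ι) (ε : ι → Equiv.Perm (Fin 2)) :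
    Equiv.Perm.sign (Equiv.prodShear π ε : Equiv.Perm (ι × Fin 2)) =
      ∏ k, Equiv.Perm.sign (ε k) := by
  have h : (Equiv.prodShear π ε : Equiv.Perm (ι × Fin 2)) =
      Equiv.prodCongrLeft (fun _ : Fin 2 => π) * Equiv.prodCongrRight ε := by
    ext x <;> simp [Equiv.prodShear]
  rw [h, Equiv.Perm.sign_mul, Equiv.Perm.sign_prodCongrLeft, Equiv.Perm.sign_prodCongrRight]
  simp

/-- If only permutations of `ι × Fin 2` preserving the partition into pairs contribute, the
unnormalised Pfaffian is a single product up to the order of the hyperoctahedral group. -/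
theorem pairedSum_of_pair_preserving (B : Matrix (ι × Fin 2) (ι × Fin 2) R)
    (hskew : ∀ x y, B x y = -B y x)
    (hB : ∀ σ : Equiv.Perm (ι × Fin 2), (∀ k, B (σ (k, 0)) (σ (k, 1)) ≠ 0) →
      ∀ k, (σ (k, 0)).1 = (σ (k, 1)).1) :
    pairedSum B =
      (2 ^ Fintype.card ι * (Nat.factorial (Fintype.card ι) : R)) *
        ∏ k : ι, B (k, 0) (k, 1) := by
  have hsum : ∑ _p : Equiv.Perm ι × (ι → Equiv.Perm (Fin 2)), ∏ k : ι, B (k, 0) (k, 1) =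
      pairedSum B := by
    refine Finset.sum_of_injOn
      (fun p => (Equiv.prodShear p.1 p.2 : Equiv.Perm (ι × Fin 2))) ?_ (by simp [Set.MapsTo]) ?_ ?_
    · rintro ⟨π, ε⟩ _ ⟨π', ε'⟩ _ h
      have h' (k : ι) (b : Fin 2) : π k = π' k ∧ ε k b = ε' k b := by
        simpa [Equiv.prodShear] using DFunLike.congr_fun h (k, b)
      exact Prod.ext (Equiv.ext fun k => (h' k 0).1)
        (funext fun k => Equiv.ext fun b => (h' k b).2)
    · intro σ _ hσ
      by_contra hne
      apply hσ
      have hpair := hB σ fun k hk =>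
        hne (mul_eq_zero_of_right _ (Finset.prod_eq_zero (Finset.mem_univ k) hk))
      have hfst (k : ι) (b : Fin 2) : (σ (k, b)).1 = (σ (k, 0)).1 := by
        fin_cases b
        · rfl
        · exact (hpair k).symm
      have hsnd (k : ι) : Function.Injective fun b : Fin 2 => (σ (k, b)).2 := by
        intro b c hbc
        have : σ (k, b) = σ (k, c) := Prod.ext ((hfst k b).trans (hfst k c).symm) hbc
        simpa using σ.injective this
      have hsurj : Function.Surjective fun k : ι => (σ (k, 0)).1 := by
        intro m
        obtain ⟨⟨k, b⟩, hkb⟩ := σ.surjective (m, 0)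
        exact ⟨k, (hfst k b).symm.trans (congrArg Prod.fst hkb)⟩
      refine ⟨(Equiv.ofBijective _ (Finite.surjective_iff_bijective.mp hsurj),
        fun k => Equiv.ofBijective _ (Finite.injective_iff_bijective.mp (hsnd k))), by simp, ?_⟩
      ext x : 1
      exact Prod.ext (hfst x.1 x.2).symm rfl
    · rintro ⟨π, ε⟩ _
      have hterm (k : ι) : B (π k, ε k 0) (π k, ε k 1) =
          ((Equiv.Perm.sign (ε k) : ℤ) : R) * B (π k, 0) (π k, 1) := by
        rcases perm_fin_two_cases (ε k) with h | h
        · simp [h]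
        · rw [h, hskew]
          simp
      have happ (k : ι) (b : Fin 2) : Equiv.prodShear π ε (k, b) = (π k, ε k b) := rfl
      simp only [happ, hterm, sign_prodShear, Finset.prod_mul_distrib, Units.coe_prod,
        Int.cast_prod]
      rw [← mul_assoc, ← Finset.prod_mul_distrib, Equiv.prod_comp π fun k => B (k, 0) (k, 1)]
      simp [← Int.cast_mul, ← Units.val_mul, Int.units_mul_self]
  rw [← hsum]
  simp [Fintype.card_perm]
  ring

end PairedSum

section Tridiagonal

variable {R : Type*} [CommRing R] {N : ℕ}

/-- A permutation mapping every pair of `Fin N × Fin 2` to two neighbours of the path on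
`2 * N` vertices preserves the partition into pairs: the path has only one perfect matching. -/
lemma pair_preserving_of_adjacent (σ : Equiv.Perm (Fin N × Fin 2))
    (h : ∀ k, ((σ (k, 0)).2 + 2 * (σ (k, 0)).1 + 1 : ℕ) = (σ (k, 1)).2 + 2 * (σ (k, 1)).1 ∨
      ((σ (k, 1)).2 + 2 * (σ (k, 1)).1 + 1 : ℕ) = (σ (k, 0)).2 + 2 * (σ (k, 0)).1) (k : Fin N) :
    (σ (k, 0)).1 = (σ (k, 1)).1 := by
  let flip : Equiv.Perm (Fin N × Fin 2) := Equiv.prodCongrRight fun _ => Equiv.swap 0 1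
  let p : Equiv.Perm (Fin N × Fin 2) := σ * flip * σ⁻¹
  have hp0 (k) : p (σ (k, 0)) = σ (k, 1) := by simp [p, flip]
  have hp1 (k) : p (σ (k, 1)) = σ (k, 0) := by simp [p, flip]
  have hadj (x) : ((p x).2 + 2 * (p x).1 + 1 : ℕ) = x.2 + 2 * x.1 ∨
      (x.2 + 2 * x.1 + 1 : ℕ) = (p x).2 + 2 * (p x).1 := by
    obtain ⟨⟨k, b⟩, rfl⟩ := σ.surjective x
    fin_cases b
    · simpa [hp0] using (h k).symm
    · simpa [hp1] using h k
  have hpp (x) : p (p x) = x := by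
    obtain ⟨⟨k, b⟩, rfl⟩ := σ.surjective x
    fin_cases b
    · simp [hp0, hp1]
    · simp [hp0, hp1]
  have hmatch (n : ℕ) : ∀ hn : n < N, p (⟨n, hn⟩, 0) = (⟨n, hn⟩, 1) := by
    induction n with
    | zero =>
      intro hn
      have := hadj (⟨0, hn⟩, 0)
      ext <;> simp at this ⊢ <;> omega
    | succ n ih =>
      intro hn
      have hprev := ih (by omega)
      rcases hadj (⟨n + 1, hn⟩, 0) with h' | h'
      · have : p (⟨n + 1, hn⟩, 0) = (⟨n, by omega⟩, 1) := by
          ext <;> simp at h' ⊢ <;> omega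
        simpa using p.injective (this.trans hprev.symm)
      · ext <;> simp at h' ⊢ <;> omega
  rw [← hp0 k]
  obtain ⟨⟨n, hn⟩, b⟩ := σ (k, 0)
  fin_cases b
  · simp [hmatch]
  · have := hpp (⟨n, hn⟩, 0)
    rw [hmatch] at this
    simp [this]

/-- The position of an element of `Fin N × Fin 2` in the lexicographic order. -/
def pairIndex (N : ℕ) : Fin N × Fin 2 ≃ Fin (2 * N) :=
  finProdFinEquiv.trans (finCongr (mul_comm N 2))

lemma pairIndex_val (x : Fin N × Fin 2) : (pairIndex N x : ℕ) = x.2 + 2 * x.1 := rfl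

lemma pfaffian_eq_pairedSum (A : Matrix (Fin (2 * N)) (Fin (2 * N)) ℝ) :
    pfaffian A = 1 / (2 ^ N * (Nat.factorial N : ℝ)) *
      pairedSum (A.submatrix (pairIndex N) (pairIndex N)) := by
  rw [pfaffian, pairedSum, ← (pairIndex N).permCongr.sum_comp]
  congr 1
  refine Finset.sum_congr rfl fun σ _ => ?_
  rw [Equiv.Perm.sign_permCongr]
  congr 1
  refine Finset.prod_congr rfl fun k _ => ?_
  have h0 : (⟨2 * (k : ℕ), by omega⟩ : Fin (2 * N)) = pairIndex N (k, 0) :=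
    Fin.ext (by simp [pairIndex_val])
  have h1 : (⟨2 * (k : ℕ) + 1, by omega⟩ : Fin (2 * N)) = pairIndex N (k, 1) :=
    Fin.ext (by simp [pairIndex_val]; omega)
  simp [h0, h1, Equiv.permCongr_apply]

theorem pfaffian_congruence (P A : Matrix (Fin (2 * N)) (Fin (2 * N)) ℝ) :
    pfaffian (P * A * P.transpose) = P.det * pfaffian A := by
  rw [pfaffian_eq_pairedSum, pfaffian_eq_pairedSum,
    ← Matrix.det_submatrix_equiv_self (pairIndex N) P, mul_left_comm, ← pairedSum_congruence,
    Matrix.transpose_submatrix, Matrix.submatrix_mul_equiv, Matrix.submatrix_mul_equiv]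

/-- The Pfaffian of a skew-symmetric tridiagonal matrix. -/
theorem pfaffian_of_tridiagonal (b : ℕ → ℝ) :
    pfaffian (Matrix.of fun i j : Fin (2 * N) =>
        if (i : ℕ) + 1 = j then b i else if (j : ℕ) + 1 = i then -b j else 0) =
      ∏ k ∈ Finset.range N, b (2 * k) := by
  rw [pfaffian_eq_pairedSum, pairedSum_of_pair_preserving]
  · rw [Fintype.card_fin, ← mul_assoc, one_div, inv_mul_cancel₀ (by positivity), one_mul,
      ← Fin.prod_univ_eq_prod_range (fun k => b (2 * k))]
    refine Finset.prod_congr rfl fun k _ => ?_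
    simp [pairIndex_val, add_comm]
  · intro x y
    simp only [Matrix.submatrix_apply, Matrix.of_apply]
    split_ifs <;> first | omega | simp
  · intro σ hσ
    refine pair_preserving_of_adjacent σ fun k => ?_
    have := hσ k
    simp only [Matrix.submatrix_apply, Matrix.of_apply, pairIndex_val] at this
    by_contra hcon
    rw [not_or] at hcon
    simp [hcon] at this

end Tridiagonal

section RogersSzego

lemma qPoch_succ (q : ℝ) (n : ℕ) : qPoch q q (n + 1) = qPoch q q n * (1 - q ^ (n + 1)) := by
  rw [qPoch, Finset.prod_range_succ, pow_succ', qPoch]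

lemma qPoch_ne_zero {q : ℝ} (hq0 : 0 < q) (hq1 : q < 1) (n : ℕ) : qPoch q q n ≠ 0 := by
  induction n with
  | zero => simp [qPoch]
  | succ n ih =>
    rw [qPoch_succ]
    exact mul_ne_zero ih (sub_pos.mpr (pow_lt_one₀ hq0.le hq1 n.succ_ne_zero)).ne'

lemma qBinom_zero_right {q : ℝ} (hq0 : 0 < q) (hq1 : q < 1) (n : ℕ) : qBinom q n 0 = 1 := by
  simp [qBinom, show qPoch q q 0 = 1 by simp [qPoch], qPoch_ne_zero hq0 hq1]

lemma qBinom_self {q : ℝ} (hq0 : 0 < q) (hq1 : q < 1) (n : ℕ) : qBinom q n n = 1 := by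
  simp [qBinom, show qPoch q q 0 = 1 by simp [qPoch], qPoch_ne_zero hq0 hq1]

/-- The three-term relation between `q`-binomial coefficients behind the recurrence of the
Rogers–Szegő polynomials. -/
lemma qBinom_add_two_succ {q : ℝ} (hq0 : 0 < q) (hq1 : q < 1) {n j : ℕ} (hj : j ≤ n) :
    qBinom q (n + 2) (j + 1) =
      qBinom q (n + 1) (j + 1) + qBinom q (n + 1) j - (1 - q ^ (n + 1)) * qBinom q n j := by
  obtain ⟨l, rfl⟩ := Nat.exists_eq_add_of_le hj
  have e1 : j + l + 2 - (j + 1) = l + 1 := by omega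
  have e2 : j + l + 1 - (j + 1) = l := by omega
  have e3 : j + l + 1 - j = l + 1 := by omega
  have e4 : j + l - j = l := by omega
  have hn := qPoch_ne_zero hq0 hq1
  have hj' : 1 - q ^ (j + 1) ≠ 0 := right_ne_zero_of_mul (qPoch_succ q j ▸ hn (j + 1))
  have hl' : 1 - q ^ (l + 1) ≠ 0 := right_ne_zero_of_mul (qPoch_succ q l ▸ hn (l + 1))
  have := hn j
  have := hn l
  simp only [qBinom, e1, e2, e3, e4, qPoch_succ q (j + l + 1), qPoch_succ q (j + l),
    qPoch_succ q j, qPoch_succ q l]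
  field_simp
  ring

/-- The Rogers–Szegő polynomial `∑_k C_q(n,k) a^k`, which is the `n`-th moment of the
Al-Salam–Carlitz I weight. -/
noncomputable def rogersSzego (q a : ℝ) (n : ℕ) : ℝ :=
  ∑ k ∈ Finset.range (n + 1), qBinom q n k * a ^ k

lemma rogersSzego_zero {q : ℝ} (hq0 : 0 < q) (hq1 : q < 1) (a : ℝ) : rogersSzego q a 0 = 1 := by
  simp [rogersSzego, qBinom_zero_right hq0 hq1]

lemma rogersSzego_one {q : ℝ} (hq0 : 0 < q) (hq1 : q < 1) (a : ℝ) :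
    rogersSzego q a 1 = 1 + a := by
  simp [rogersSzego, Finset.sum_range_succ, qBinom_zero_right hq0 hq1, qBinom_self hq0 hq1]

lemma rogersSzego_add_two {q : ℝ} (hq0 : 0 < q) (hq1 : q < 1) (a : ℝ) (n : ℕ) :
    rogersSzego q a (n + 2) =
      (1 + a) * rogersSzego q a (n + 1) - a * (1 - q ^ (n + 1)) * rogersSzego q a n := by
  have h1 : rogersSzego q a (n + 1) =
      ∑ j ∈ Finset.range (n + 1), qBinom q (n + 1) (j + 1) * a ^ (j + 1) + 1 := by
    rw [rogersSzego, Finset.sum_range_succ', qBinom_zero_right hq0 hq1, pow_zero, mul_one]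
  have h2 : rogersSzego q a (n + 1) =
      ∑ j ∈ Finset.range (n + 1), qBinom q (n + 1) j * a ^ j + a ^ (n + 1) := by
    rw [rogersSzego, Finset.sum_range_succ, qBinom_self hq0 hq1, one_mul]
  have h3 : rogersSzego q a (n + 2) =
      ∑ j ∈ Finset.range (n + 1), qBinom q (n + 2) (j + 1) * a ^ (j + 1) + a ^ (n + 2) + 1 := by
    rw [rogersSzego, Finset.sum_range_succ', Finset.sum_range_succ, qBinom_zero_right hq0 hq1,
      qBinom_self hq0 hq1, pow_zero, mul_one, one_mul]
  have h4 : ∑ j ∈ Finset.range (n + 1), qBinom q (n + 2) (j + 1) * a ^ (j + 1) =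
      ∑ j ∈ Finset.range (n + 1), qBinom q (n + 1) (j + 1) * a ^ (j + 1) +
        a * ∑ j ∈ Finset.range (n + 1), qBinom q (n + 1) j * a ^ j -
        a * (1 - q ^ (n + 1)) * rogersSzego q a n := by
    rw [rogersSzego, Finset.mul_sum, Finset.mul_sum, ← Finset.sum_add_distrib,
      ← Finset.sum_sub_distrib]
    refine Finset.sum_congr rfl fun j hj => ?_
    rw [qBinom_add_two_succ hq0 hq1 (Nat.lt_succ_iff.mp (Finset.mem_range.mp hj))]
    ring
  linear_combination h3 + h4 - h1 - a * h2

end RogersSzego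

section AlSalamCarlitz

/-- The scaled `q`-derivative `f ↦ (f(x) - f(qx)) / x` on polynomials. -/
noncomputable def scaledQDeriv (q : ℝ) : ℝ[X] →ₗ[ℝ] ℝ[X] :=
  Polynomial.lsum fun n => (1 - q ^ n) • Polynomial.monomial (n - 1)

lemma scaledQDeriv_monomial (q : ℝ) (n : ℕ) (c : ℝ) :
    scaledQDeriv q (monomial n c) = monomial (n - 1) ((1 - q ^ n) * c) := by
  simp [scaledQDeriv, Polynomial.lsum_apply, Polynomial.sum_monomial_index,
    Polynomial.smul_monomial]

lemma scaledQDeriv_X_mul (q : ℝ) (p : ℝ[X]) :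
    scaledQDeriv q (X * p) = C (1 - q) * p + C q * (X * scaledQDeriv q p) := by
  induction p using Polynomial.induction_on' with
  | add f g hf hg => rw [mul_add, map_add, map_add, hf, hg]; ring
  | monomial n c =>
    rw [X_mul_monomial, scaledQDeriv_monomial, scaledQDeriv_monomial, X_mul_monomial,
      C_mul_monomial, C_mul_monomial]
    rcases n with _ | n
    · simp
    · simp only [Nat.add_sub_cancel, ← map_add]
      congr 1
      ring

/-- The moment functional of the Al-Salam–Carlitz I weight. -/
noncomputable def momentFunctional (q a : ℝ) : ℝ[X] →ₗ[ℝ] ℝ :=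
  Polynomial.lsum fun n => rogersSzego q a n • LinearMap.id

lemma momentFunctional_monomial (q a : ℝ) (n : ℕ) (c : ℝ) :
    momentFunctional q a (monomial n c) = rogersSzego q a n * c := by
  simp [momentFunctional, Polynomial.lsum_apply, Polynomial.sum_monomial_index]

lemma momentFunctional_C_mul (q a c : ℝ) (p : ℝ[X]) :
    momentFunctional q a (C c * p) = c * momentFunctional q a p := by
  rw [← smul_eq_C_mul, map_smul, smul_eq_mul]

/-- The Pearson equation of the Al-Salam–Carlitz I weight. -/
lemma momentFunctional_X_mul {q : ℝ} (hq0 : 0 < q) (hq1 : q < 1) (a : ℝ) (p : ℝ[X]) :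
    momentFunctional q a (X * p) =
      (1 + a) * momentFunctional q a p - a * momentFunctional q a (scaledQDeriv q p) := by
  induction p using Polynomial.induction_on' with
  | add f g hf hg => rw [mul_add, map_add, map_add, map_add, map_add, hf, hg]; ring
  | monomial n c =>
    rw [X_mul_monomial, scaledQDeriv_monomial]
    simp only [momentFunctional_monomial]
    rcases n with _ | n
    · simp [rogersSzego_zero hq0 hq1, rogersSzego_one hq0 hq1]
    · rw [rogersSzego_add_two hq0 hq1, Nat.add_sub_cancel]
      ring

/-- The monic Al-Salam–Carlitz I polynomials, given by their three-term recurrence. -/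
noncomputable def alSalamCarlitz (q a : ℝ) : ℕ → ℝ[X]
  | 0 => 1
  | 1 => X - C (1 + a)
  | n + 2 => X * alSalamCarlitz q a (n + 1) - C ((1 + a) * q ^ (n + 1)) * alSalamCarlitz q a (n + 1)
      + C (a * q ^ n * (1 - q ^ (n + 1))) * alSalamCarlitz q a n

/-- The recurrence without case distinction; at `n = 0` the last coefficient vanishes. -/
lemma X_mul_alSalamCarlitz (q a : ℝ) (n : ℕ) :
    X * alSalamCarlitz q a n = alSalamCarlitz q a (n + 1)
      + C ((1 + a) * q ^ n) * alSalamCarlitz q a n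
      - C (a * q ^ (n - 1) * (1 - q ^ n)) * alSalamCarlitz q a (n - 1) := by
  rcases n with _ | n
  · simp [alSalamCarlitz]
  · rw [alSalamCarlitz, Nat.add_sub_cancel]
    ring

lemma scaledQDeriv_C_mul (q c : ℝ) (p : ℝ[X]) :
    scaledQDeriv q (C c * p) = C c * scaledQDeriv q p := by
  rw [← smul_eq_C_mul, map_smul, smul_eq_C_mul]

/-- The `q`-derivative lowers the index of the Al-Salam–Carlitz I polynomials. -/
lemma scaledQDeriv_alSalamCarlitz (q a : ℝ) (n : ℕ) :
    scaledQDeriv q (alSalamCarlitz q a n) = C (1 - q ^ n) * alSalamCarlitz q a (n - 1) := by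
  have h0 : scaledQDeriv q (alSalamCarlitz q a 0) = 0 := by
    have := scaledQDeriv_monomial q 0 1
    simpa [alSalamCarlitz] using this
  induction n using Nat.strong_induction_on with
  | _ n ih =>
    rcases n with _ | n
    · simpa using h0
    have hrec := X_mul_alSalamCarlitz q a n
    have hU : alSalamCarlitz q a (n + 1) = X * alSalamCarlitz q a n
        - C ((1 + a) * q ^ n) * alSalamCarlitz q a n
        + C (a * q ^ (n - 1) * (1 - q ^ n)) * alSalamCarlitz q a (n - 1) := by
      rw [hrec]; ring
    rw [hU, map_add, map_sub, scaledQDeriv_C_mul, scaledQDeriv_C_mul, scaledQDeriv_X_mul,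
      ih n (by omega), ih (n - 1) (by omega), Nat.add_sub_cancel]
    rcases n with _ | n
    · simp
    have hrec' := X_mul_alSalamCarlitz q a n
    simp only [Nat.add_sub_cancel]
    simp only [map_sub, map_mul, map_add, map_one, map_pow] at hrec' ⊢
    rcases n with _ | n
    · simp at hrec' ⊢
      linear_combination C q * (1 - C q) * hrec'
    · simp only [Nat.add_sub_cancel] at hrec' ⊢
      linear_combination C q * (1 - C q ^ (n + 2)) * hrec'

lemma momentFunctional_alSalamCarlitz {q : ℝ} (hq0 : 0 < q) (hq1 : q < 1) (a : ℝ) (n : ℕ) :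
    momentFunctional q a (alSalamCarlitz q a n) = if n = 0 then 1 else 0 := by
  induction n using Nat.strong_induction_on with
  | _ n ih =>
    rcases n with _ | n
    · have := momentFunctional_monomial q a 0 1
      simpa [alSalamCarlitz, rogersSzego_zero hq0 hq1] using this
    have hrec := congrArg (momentFunctional q a) (X_mul_alSalamCarlitz q a n)
    rw [momentFunctional_X_mul hq0 hq1, scaledQDeriv_alSalamCarlitz] at hrec
    simp only [map_sub (momentFunctional q a), map_add (momentFunctional q a),
      momentFunctional_C_mul, ih n (by omega), ih (n - 1) (by omega)] at hrec
    rcases n with _ | _ | n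
    · simp at hrec ⊢
      linarith
    · simp at hrec ⊢
      linarith
    · simp at hrec ⊢
      linarith

/-- The squared norm of the `n`-th Al-Salam–Carlitz I polynomial. -/
noncomputable def alSalamCarlitzNorm (q a : ℝ) (n : ℕ) : ℝ :=
  ∏ k ∈ Finset.range n, (-(a * q ^ k * (1 - q ^ (k + 1))))

lemma alSalamCarlitzNorm_succ (q a : ℝ) (n : ℕ) : alSalamCarlitzNorm q a (n + 1) =
    alSalamCarlitzNorm q a n * -(a * q ^ n * (1 - q ^ (n + 1))) :=
  Finset.prod_range_succ _ _

theorem momentFunctional_mul_alSalamCarlitz {q : ℝ} (hq0 : 0 < q) (hq1 : q < 1) (a : ℝ)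
    (m n : ℕ) :
    momentFunctional q a (alSalamCarlitz q a m * alSalamCarlitz q a n) =
      if m = n then alSalamCarlitzNorm q a n else 0 := by
  induction m using Nat.strong_induction_on generalizing n with
  | _ m ih =>
    rcases m with _ | m
    · rw [alSalamCarlitz, one_mul, momentFunctional_alSalamCarlitz hq0 hq1]
      rcases n with _ | n <;> simp [alSalamCarlitzNorm]
    set U := alSalamCarlitz q a
    set L := momentFunctional q a
    have hcomm : L (X * U m * U n) = L (U m * (X * U n)) := by ring_nf
    have hleft : L (X * U m * U n) = L (U (m + 1) * U n) + (1 + a) * q ^ m * L (U m * U n)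
        - a * q ^ (m - 1) * (1 - q ^ m) * L (U (m - 1) * U n) := by
      rw [X_mul_alSalamCarlitz, sub_mul, add_mul, mul_assoc, mul_assoc, map_sub, map_add,
        momentFunctional_C_mul, momentFunctional_C_mul]
    have hright : L (U m * (X * U n)) = L (U m * U (n + 1)) + (1 + a) * q ^ n * L (U m * U n)
        - a * q ^ (n - 1) * (1 - q ^ n) * L (U m * U (n - 1)) := by
      rw [X_mul_alSalamCarlitz, mul_sub, mul_add, mul_left_comm, mul_left_comm (U m), map_sub,
        map_add, momentFunctional_C_mul, momentFunctional_C_mul]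
    rw [hleft, hright, ih m (by omega), ih m (by omega), ih m (by omega),
      ih (m - 1) (by omega)] at hcomm
    have key := eq_sub_of_add_eq (eq_add_of_sub_eq hcomm)
    rw [key]
    rcases lt_trichotomy m n with h | rfl | h
    · rcases n with _ | n
      · omega
      by_cases hmn : m = n
      · subst hmn
        simp [alSalamCarlitzNorm_succ, show m - 1 ≠ m + 1 by omega, show m ≠ m + 1 + 1 by omega]
        ring
      · simp [hmn, show m ≠ n + 1 by omega, show m ≠ n + 2 by omega,
          show m - 1 ≠ n + 1 by omega]
    · rcases m with _ | m
      · simp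
      · simp
    · rcases m with _ | m
      · omega
      by_cases hmn : m = n
      · subst hmn
        simp [alSalamCarlitzNorm_succ, show m + 1 ≠ m - 1 by omega, show m + 1 + 1 ≠ m by omega]
        ring
      · simp [hmn, show m + 1 ≠ n by omega, show m + 2 ≠ n by omega, show m + 1 ≠ n - 1 by omega]

lemma alSalamCarlitz_natDegree_le_coeff_eq_one (q a : ℝ) (n : ℕ) :
    (alSalamCarlitz q a n).natDegree ≤ n ∧ (alSalamCarlitz q a n).coeff n = 1 := by
  induction n using Nat.strong_induction_on with
  | _ n ih =>
    rcases n with _ | n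
    · simp [alSalamCarlitz]
    have hU : alSalamCarlitz q a (n + 1) = X * alSalamCarlitz q a n
        - C ((1 + a) * q ^ n) * alSalamCarlitz q a n
        + C (a * q ^ (n - 1) * (1 - q ^ n)) * alSalamCarlitz q a (n - 1) := by
      rw [X_mul_alSalamCarlitz]; ring
    obtain ⟨hd, hc⟩ := ih n (by omega)
    obtain ⟨hd', -⟩ := ih (n - 1) (by omega)
    constructor
    · rw [hU, natDegree_le_iff_coeff_eq_zero]
      intro k hk
      obtain ⟨k, rfl⟩ := Nat.exists_eq_add_one_of_ne_zero (show k ≠ 0 by omega)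
      simp only [coeff_add, coeff_sub, coeff_X_mul, coeff_C_mul]
      rw [coeff_eq_zero_of_natDegree_lt (by omega), coeff_eq_zero_of_natDegree_lt (by omega),
        coeff_eq_zero_of_natDegree_lt (by omega)]
      simp
    · rw [hU]
      simp only [coeff_add, coeff_sub, coeff_X_mul, coeff_C_mul, hc]
      rw [coeff_eq_zero_of_natDegree_lt (by omega), coeff_eq_zero_of_natDegree_lt (by omega)]
      simp

/-- The skew-symmetric form whose Gram matrix on monomials is the Catalan–Hankel matrix. -/
noncomputable def skewForm (q a : ℝ) : ℝ[X] →ₗ[ℝ] ℝ[X] →ₗ[ℝ] ℝ :=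
  LinearMap.mk₂ ℝ
    (fun f g => momentFunctional q a (f * scaledQDeriv q g - g * scaledQDeriv q f))
    (fun f f' g => by rw [← map_add, map_add]; ring_nf)
    (fun c f g => by simp [← smul_sub])
    (fun f g g' => by rw [← map_add, map_add]; ring_nf)
    (fun c f g => by simp [← smul_sub])

lemma skewForm_apply (q a : ℝ) (f g : ℝ[X]) : skewForm q a f g =
    momentFunctional q a (f * scaledQDeriv q g - g * scaledQDeriv q f) := rfl

lemma skewForm_X_pow (q a : ℝ) (i j : ℕ) :
    skewForm q a (X ^ i) (X ^ j) =
      (q ^ i - q ^ j) * ∑ k ∈ Finset.range (i + j), qBinom q (i + j - 1) k * a ^ k := by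
  have hmu (h : i + j ≠ 0) : ∑ k ∈ Finset.range (i + j), qBinom q (i + j - 1) k * a ^ k =
      rogersSzego q a (i + j - 1) := by
    rw [rogersSzego, Nat.sub_add_cancel (Nat.one_le_iff_ne_zero.mpr h)]
  simp only [skewForm_apply, ← monomial_one_right_eq_X_pow, scaledQDeriv_monomial, map_sub,
    monomial_mul_monomial, momentFunctional_monomial]
  rcases i with _ | i <;> rcases j with _ | j
  · simp
  · rw [hmu (by omega)]
    simp
    ring
  · rw [hmu (by omega)]
    simp
    ring
  · rw [hmu (by omega), show i + 1 + (j + 1) - 1 = i + j + 1 by omega,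
      show i + 1 + (j + 1 - 1) = i + j + 1 by omega, show j + 1 + (i + 1 - 1) = i + j + 1 by omega]
    ring

lemma skewForm_alSalamCarlitz {q : ℝ} (hq0 : 0 < q) (hq1 : q < 1) (a : ℝ) (m n : ℕ) :
    skewForm q a (alSalamCarlitz q a m) (alSalamCarlitz q a n) =
      if m + 1 = n then (1 - q ^ (m + 1)) * alSalamCarlitzNorm q a m
      else if n + 1 = m then -((1 - q ^ (n + 1)) * alSalamCarlitzNorm q a n) else 0 := by
  rw [skewForm_apply, scaledQDeriv_alSalamCarlitz, scaledQDeriv_alSalamCarlitz,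
    mul_left_comm, mul_left_comm (alSalamCarlitz q a n), map_sub, momentFunctional_C_mul,
    momentFunctional_C_mul, momentFunctional_mul_alSalamCarlitz hq0 hq1,
    momentFunctional_mul_alSalamCarlitz hq0 hq1]
  rcases m with _ | m <;> rcases n with _ | n
  · simp
  · simp only [Nat.add_sub_cancel]
    split_ifs <;> simp_all
  · simp only [Nat.add_sub_cancel]
    split_ifs <;> simp_all
  · simp only [Nat.add_sub_cancel]
    split_ifs <;> first | omega | (subst_vars; simp)

/-- The Gram matrix on monomials is congruent to the one on Al-Salam–Carlitz I polynomials. -/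
lemma gram_alSalamCarlitz (q a : ℝ) (M : ℕ) :
    (Matrix.of fun m n : Fin M => skewForm q a (alSalamCarlitz q a m) (alSalamCarlitz q a n)) =
      (Matrix.of fun m i : Fin M => (alSalamCarlitz q a m).coeff i) *
        (Matrix.of fun i j : Fin M => skewForm q a (X ^ (i : ℕ)) (X ^ (j : ℕ))) *
        (Matrix.of fun m i : Fin M => (alSalamCarlitz q a m).coeff i).transpose := by
  have hexp (m : Fin M) : alSalamCarlitz q a m =
      ∑ i : Fin M, (alSalamCarlitz q a m).coeff i • X ^ (i : ℕ) := by
    rw [Fin.sum_univ_eq_sum_range fun i => (alSalamCarlitz q a m).coeff i • (X : ℝ[X]) ^ i]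
    conv_lhs => rw [(alSalamCarlitz q a m).as_sum_range_C_mul_X_pow'
      (lt_of_le_of_lt (alSalamCarlitz_natDegree_le_coeff_eq_one q a m).1 m.isLt)]
    simp [smul_eq_C_mul]
  ext m n
  simp only [Matrix.of_apply, Matrix.mul_apply, Matrix.transpose_apply]
  conv_lhs => rw [hexp m, hexp n]
  simp only [map_sum, map_smul, LinearMap.sum_apply, LinearMap.smul_apply, smul_eq_mul,
    Finset.mul_sum, Finset.sum_mul]
  refine Finset.sum_congr rfl fun j _ => Finset.sum_congr rfl fun i _ => ?_
  ring

lemma det_coeff_alSalamCarlitz (q a : ℝ) (M : ℕ) :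
    (Matrix.of fun m i : Fin M => (alSalamCarlitz q a m).coeff i).det = 1 := by
  rw [Matrix.det_of_isLowerTriangular]
  · simp [(alSalamCarlitz_natDegree_le_coeff_eq_one q a _).2]
  · intro m i h
    exact coeff_eq_zero_of_natDegree_lt
      (lt_of_le_of_lt (alSalamCarlitz_natDegree_le_coeff_eq_one q a m).1 h)

lemma alSalamCarlitzNorm_eq (q a : ℝ) (n : ℕ) :
    alSalamCarlitzNorm q a n = (-a) ^ n * q ^ n.choose 2 * qPoch q q n := by
  induction n with
  | zero => simp [alSalamCarlitzNorm, qPoch]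
  | succ n ih =>
    rw [alSalamCarlitzNorm_succ, ih, qPoch_succ, Nat.choose_succ_succ', Nat.choose_one_right]
    ring

lemma prod_alSalamCarlitzNorm {q : ℝ} (hq0 : 0 < q) (a : ℝ) (N : ℕ) :
    ∏ k ∈ Finset.range N, (1 - q ^ (2 * k + 1)) * alSalamCarlitzNorm q a (2 * k) =
      a ^ (N * (N - 1)) * q ^ ((N : ℝ) * ((N : ℝ) - 1) * (4 * (N : ℝ) - 5) / 6) *
        ∏ k ∈ Finset.range N, qPoch q q (2 * k + 1) := by
  induction N with
  | zero => simp
  | succ N ih =>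
    have ha : a ^ ((N + 1) * (N + 1 - 1)) = a ^ (N * (N - 1)) * a ^ (2 * N) := by
      rw [← pow_add]
      congr 1
      rcases N with _ | N
      · rfl
      · simp only [Nat.add_sub_cancel]; ring
    have hq : q ^ (((N + 1 : ℕ) : ℝ) * (((N + 1 : ℕ) : ℝ) - 1) * (4 * ((N + 1 : ℕ) : ℝ) - 5) / 6) =
        q ^ ((N : ℝ) * ((N : ℝ) - 1) * (4 * (N : ℝ) - 5) / 6) * q ^ (2 * N).choose 2 := by
      rw [← Real.rpow_natCast, ← Real.rpow_add hq0, Nat.cast_choose_two]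
      congr 1
      push_cast
      ring
    rw [Finset.prod_range_succ, Finset.prod_range_succ, ih, ha, hq, alSalamCarlitzNorm_eq,
      qPoch_succ, (even_two_mul N).neg_pow]
    ring

end AlSalamCarlitz

theorem pfaffian_alSalamCarlitzI (q : ℝ) (hq0 : 0 < q) (hq1 : q < 1) (a : ℝ) (N : ℕ) (hN : 0 < N) :
    pfaffian (fun i j : Fin (2 * N) =>
        (q ^ (i : ℕ) - q ^ (j : ℕ)) *
          ∑ k ∈ Finset.range ((i : ℕ) + (j : ℕ)), qBinom q ((i : ℕ) + (j : ℕ) - 1) k * a ^ k) =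
      a ^ (N * (N - 1)) * q ^ ((N : ℝ) * ((N : ℝ) - 1) * (4 * (N : ℝ) - 5) / 6) *
        ∏ k ∈ Finset.range N, qPoch q q (2 * k + 1) := by
  have hgram := congrArg pfaffian (gram_alSalamCarlitz q a (2 * N))
  rw [pfaffian_congruence, det_coeff_alSalamCarlitz, one_mul] at hgram
  simp only [skewForm_alSalamCarlitz hq0 hq1, skewForm_X_pow] at hgram
  rw [pfaffian_of_tridiagonal fun k => (1 - q ^ (k + 1)) * alSalamCarlitzNorm q a k] at hgram
  exact hgram.symm.trans (prod_alSalamCarlitzNorm hq0 a N)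
end
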